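/- arXiv:1307.4973 — 2 statements merged into one kernel-verified Lean document; each statement's English description precedes it below -/
import Mathlib

section
/- Assume m_i = m for all i ∈ I, that each matrix F_i is diagonal, and that there exist ν > 0, μ ∈ ℝ and diagonal positive definite matrices Q_i = diag[Q_i⁻, Q_i⁺] ∈ ℝ^{n×n} such that, setting 𝒬_i(x) = diag[e^{2μx} Q_i⁻, e^{−2μx} Q_i⁺], for all i ∈ I: −μΛ_i⁺ + F_i ≤ −νIₙ, and E₀ᵢᵀ 𝒬_i(0) Λ_i E₀ᵢ ≤ E₁ᵢᵀ 𝒬_i(1) Λ_i E₁ᵢ where E₀ᵢ = [[I_m, 0],[G_{i+−}, G_{i++}]] and E₁ᵢ = [[G_{i−−}, G_{i−+}],[0, I_{n−m}]], together with (S_i⁺)ᵀQ_i⁺S_i⁺ = (S_j⁺)ᵀQ_j⁺S_j⁺ and (S_i⁻)ᵀQ_i⁻S_i⁻ = (S_j⁻)ᵀQ_j⁻S_j⁻ for all i,j ∈ I. Then the switched linear hyperbolic system is globally uniformly exponentially stable with respect to the set of all switching signals: there exist ν' > 0 and C > 0 such that for every switching signal σ and every classical solution w, ‖w(t,·)‖_{L²((0,1);ℝⁿ)}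 ≤ C e^{−ν't} ‖w(0,·)‖_{L²((0,1);ℝⁿ)} for all t ≥ 0. -/
open Matrix Set Real

noncomputable section

/-- Loewner order on real matrices: `matLE A B` iff `B - A` is positive semidefinite. -/
def matLE {ι : Type*} [Fintype ι] (A B : Matrix ι ι ℝ) : Prop := (B - A).PosSemidef

/-- A quadratic form `Sᵀ * diagonal d * S` is a weighted sum of squares. -/
theorem dotProduct_transpose_diagonal_mulVec {ι : Type*} [Fintype ι] [DecidableEq ι]
    (S : Matrix ι ι ℝ) (d v : ι → ℝ) :
    v ⬝ᵥ (Sᵀ * Matrix.diagonal d * S) *ᵥ v = ∑ k, d k * (S *ᵥ v) k ^ 2 := by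
  rw [← Matrix.mulVec_mulVec, ← Matrix.mulVec_mulVec, Matrix.dotProduct_mulVec,
    Matrix.vecMul_transpose]
  simp only [dotProduct, Matrix.mulVec_diagonal]
  exact Finset.sum_congr rfl fun k _ => by ring

/-- The entries of a matrix bound its action in the sum-of-squares norm. -/
theorem sum_sq_mulVec_le {ι : Type*} [Fintype ι] (M : Matrix ι ι ℝ) (v : ι → ℝ) :
    ∑ k, (M *ᵥ v) k ^ 2 ≤ (∑ k, ∑ l, M k l ^ 2 + 1) * ∑ k, v k ^ 2 := by
  have h : ∑ k, (M *ᵥ v) k ^ 2 ≤ (∑ k, ∑ l, M k l ^ 2) * ∑ k, v k ^ 2 := by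
    rw [Finset.sum_mul]
    exact Finset.sum_le_sum fun k _ => Finset.sum_mul_sq_le_sq_mul_sq _ _ _
  have h0 : 0 ≤ ∑ k, v k ^ 2 := Finset.sum_nonneg fun k _ => sq_nonneg _
  linarith

/-- Energy inequality for a scalar transport equation `∂ₜy + l ∂ₓy = d y` on a rectangle. -/
theorem transport_energy_le {a b l d c ν : ℝ} (hab : a ≤ b)
    (hd : 2 * ν + 2 * d + c * l ≤ 0) (y : ℝ × ℝ → ℝ) (y' : ℝ × ℝ → ℝ × ℝ →L[ℝ] ℝ)
    (hy : ContinuousOn y (Icc a b ×ˢ Icc (0 : ℝ) 1))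
    (hy' : ∀ p ∈ Ioo a b ×ˢ Ioo (0 : ℝ) 1, HasFDerivAt y (y' p) p)
    (hpde : ∀ p ∈ Icc a b ×ˢ Icc (0 : ℝ) 1, y' p (1, 0) + l * y' p (0, 1) = d * y p) :
    (∫ t in a..b, l * exp (2 * ν * t + c * 1) * y (t, 1) ^ 2) -
        (∫ t in a..b, l * exp (2 * ν * t + c * 0) * y (t, 0) ^ 2) +
        (∫ x in (0 : ℝ)..1, exp (2 * ν * b + c * x) * y (b, x) ^ 2) ≤
      ∫ x in (0 : ℝ)..1, exp (2 * ν * a + c * x) * y (a, x) ^ 2 := by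
  set e : ℝ × ℝ → ℝ := fun p => exp (2 * ν * p.1 + c * p.2) with he
  set e' : ℝ × ℝ → ℝ × ℝ →L[ℝ] ℝ := fun p =>
    e p • ((2 * ν) • ContinuousLinearMap.fst ℝ ℝ ℝ + c • ContinuousLinearMap.snd ℝ ℝ ℝ) with he'
  have hede : ∀ p, HasFDerivAt e (e' p) p := fun p =>
    ((hasFDerivAt_fst.const_mul (2 * ν)).add (hasFDerivAt_snd.const_mul c)).exp
  set f : ℝ × ℝ → ℝ := fun p => e p * y p ^ 2 with hf
  set f' : ℝ × ℝ → ℝ × ℝ →L[ℝ] ℝ := fun p =>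
    e p • ((2 * y p) • y' p) + (y p ^ 2) • e' p with hf'
  have hec : Continuous e := by rw [he]; fun_prop
  have hfc : ContinuousOn f (Icc a b ×ˢ Icc (0 : ℝ) 1) := hec.continuousOn.mul (hy.pow 2)
  have hfd : ∀ p ∈ Ioo a b ×ˢ Ioo (0 : ℝ) 1, HasFDerivAt f (f' p) p := by
    intro p hp
    have h := (hede p).mul ((hy' p hp).pow 2)
    rw [show 2 • y p ^ (2 - 1) = 2 * y p by simp] at h
    exact h
  have hdiv : ∀ p ∈ Icc a b ×ˢ Icc (0 : ℝ) 1,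
      f' p (1, 0) + (l • f' p) (0, 1) = (2 * ν + 2 * d + c * l) * f p := by
    intro p hp
    have h := hpde p hp
    simp only [hf', he', hf, _root_.add_apply, _root_.smul_apply, ContinuousLinearMap.coe_fst',
      ContinuousLinearMap.coe_snd', smul_eq_mul]
    linear_combination (2 * e p * y p) * h
  have key := MeasureTheory.integral2_divergence_prod_of_hasFDerivAt_off_countable
    f (fun p => l * f p) f' (fun p => l • f' p) a 0 b 1 ∅ countable_empty
    (by rw [uIcc_of_le hab, uIcc_of_le zero_le_one]; exact hfc)
    (by rw [uIcc_of_le hab, uIcc_of_le zero_le_one]; exact continuousOn_const.mul hfc)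
    (by
      rw [min_eq_left hab, max_eq_right hab, min_eq_left zero_le_one, max_eq_right zero_le_one]
      exact fun p hp => hfd p hp.1)
    (by
      rw [min_eq_left hab, max_eq_right hab, min_eq_left zero_le_one, max_eq_right zero_le_one]
      exact fun p hp => (hfd p hp.1).const_mul l)
    (by
      rw [uIcc_of_le hab, uIcc_of_le zero_le_one]
      refine ((continuousOn_const.mul hfc).congr hdiv).integrableOn_compact
        (isCompact_Icc.prod isCompact_Icc))
  have hneg : (∫ t in a..b, ∫ x in (0 : ℝ)..1, f' (t, x) (1, 0) + (l • f' (t, x)) (0, 1)) ≤ 0 := by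
    rw [← neg_nonneg, ← intervalIntegral.integral_neg]
    refine intervalIntegral.integral_nonneg hab fun t ht => ?_
    rw [← intervalIntegral.integral_neg]
    refine intervalIntegral.integral_nonneg zero_le_one fun x hx => ?_
    rw [hdiv (t, x) ⟨ht, hx⟩]
    have : 0 ≤ f (t, x) := mul_nonneg (exp_pos _).le (sq_nonneg _)
    nlinarith
  simp only [hf, he] at key hneg
  simp only [mul_assoc l]
  linarith

/-- Chaining exponential decay over finitely many breakpoints. -/
theorem exp_decay_of_piecewise {V : ℝ → ℝ} {r : ℝ} {times : Set ℝ}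
    (hfin : ∀ T : ℝ, (times ∩ Icc 0 T).Finite)
    (hV : ∀ a b : ℝ, 0 ≤ a → a < b → (∀ u, a < u → u < b → u ∉ times) →
      V b ≤ exp (-r * (b - a)) * V a) {t : ℝ} (ht : 0 ≤ t) :
    V t ≤ exp (-r * t) * V 0 := by
  have hfin' : ∀ T : ℝ, (times ∩ Ioo 0 T).Finite := fun T =>
    (hfin T).subset (inter_subset_inter_right _ Ioo_subset_Icc_self)
  induction hN : (times ∩ Ioo 0 t).ncard using Nat.strong_induction_on generalizing t with
  | _ N ih =>
    rcases ht.eq_or_lt with rfl | ht'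
    · simp
    rcases (times ∩ Ioo 0 t).eq_empty_or_nonempty with h | h
    · have := hV 0 t le_rfl ht' fun u h0 h1 hu => by
        have : u ∈ times ∩ Ioo 0 t := ⟨hu, h0, h1⟩
        simp [h] at this
      simpa using this
    · obtain ⟨s, hs, hmax⟩ := (times ∩ Ioo 0 t).exists_max_image id (hfin' t) h
      have h1 := hV s t hs.2.1.le hs.2.2 fun u h0 h1 hu =>
        (hmax u ⟨hu, hs.2.1.trans h0, h1⟩).not_gt h0
      have hlt : (times ∩ Ioo 0 s).ncard < N := by
        rw [← hN]
        refine ncard_lt_ncard ⟨fun u hu => ⟨hu.1, hu.2.1, hu.2.2.trans hs.2.2⟩, fun hsub => ?_⟩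
          (hfin' t)
        exact lt_irrefl s (hsub hs).2.2
      have h2 := ih _ hlt hs.2.1.le rfl
      calc V t ≤ exp (-r * (t - s)) * V s := h1
        _ ≤ exp (-r * (t - s)) * (exp (-r * s) * V 0) := by gcongr
        _ = exp (-r * t) * V 0 := by rw [← mul_assoc, ← exp_add]; ring_nf

/-- Energy decay for a system of transport equations with dissipative boundary terms. -/
theorem diagonal_transport_energy_le {n : ℕ} {a b ν : ℝ} (hab : a ≤ b) (l d c q : Fin n → ℝ)
    (hq : ∀ k, 0 < q k) (hd : ∀ k, 2 * ν + 2 * d k + c k * l k ≤ 0)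
    (y : ℝ × ℝ → Fin n → ℝ) (y' : ℝ × ℝ → ℝ × ℝ →L[ℝ] Fin n → ℝ)
    (hy : ContinuousOn y (Icc a b ×ˢ Icc (0 : ℝ) 1))
    (hy' : ∀ p ∈ Ioo a b ×ˢ Ioo (0 : ℝ) 1, HasFDerivAt y (y' p) p)
    (hpde : ∀ p ∈ Icc a b ×ˢ Icc (0 : ℝ) 1, ∀ k,
      y' p (1, 0) k + l k * y' p (0, 1) k = d k * y p k)
    (hbd : ∀ t ∈ Icc a b, ∑ k, exp (c k * 0) * q k * l k * y (t, 0) k ^ 2 ≤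
      ∑ k, exp (c k * 1) * q k * l k * y (t, 1) k ^ 2) :
    ∫ x in (0 : ℝ)..1, ∑ k, exp (c k * x) * q k * y (b, x) k ^ 2 ≤
      exp (-(2 * ν) * (b - a)) *
        ∫ x in (0 : ℝ)..1, ∑ k, exp (c k * x) * q k * y (a, x) k ^ 2 := by
  have hyc : ∀ k, ContinuousOn (fun p => y p k) (Icc a b ×ˢ Icc (0 : ℝ) 1) := fun k =>
    (continuous_apply k).comp_continuousOn hy
  have hyx : ∀ k, ∀ t ∈ Icc a b, ContinuousOn (fun x => y (t, x) k) (Icc 0 1) := fun k t ht =>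
    (hyc k).comp (by fun_prop) fun x hx => ⟨ht, hx⟩
  have hyt : ∀ k, ∀ x ∈ Icc (0 : ℝ) 1, ContinuousOn (fun t => y (t, x) k) (Icc a b) :=
    fun k x hx => (hyc k).comp (by fun_prop) fun t ht => ⟨ht, hx⟩
  have hxint : ∀ k, ∀ t ∈ Icc a b, IntervalIntegrable
      (fun x => exp (c k * x) * q k * y (t, x) k ^ 2) MeasureTheory.volume 0 1 := by
    intro k t ht
    refine ContinuousOn.intervalIntegrable ?_
    rw [uIcc_of_le zero_le_one]
    exact ContinuousOn.mul (by fun_prop) ((hyx k t ht).pow 2)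
  have htint : ∀ k, ∀ x ∈ Icc (0 : ℝ) 1, IntervalIntegrable
      (fun t => exp (2 * ν * t) * (exp (c k * x) * q k * l k * y (t, x) k ^ 2))
      MeasureTheory.volume a b := by
    intro k x hx
    refine ContinuousOn.intervalIntegrable ?_
    rw [uIcc_of_le hab]
    exact ContinuousOn.mul (by fun_prop) (continuousOn_const.mul ((hyt k x hx).pow 2))
  have hcomp : ∀ k,
      (∫ t in a..b, exp (2 * ν * t) * (exp (c k * 1) * q k * l k * y (t, 1) k ^ 2)) -
        (∫ t in a..b, exp (2 * ν * t) * (exp (c k * 0) * q k * l k * y (t, 0) k ^ 2)) +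
        exp (2 * ν * b) * (∫ x in (0 : ℝ)..1, exp (c k * x) * q k * y (b, x) k ^ 2) ≤
      exp (2 * ν * a) * ∫ x in (0 : ℝ)..1, exp (c k * x) * q k * y (a, x) k ^ 2 := by
    intro k
    have h := transport_energy_le hab (hd k) (fun p => y p k)
      (fun p => (ContinuousLinearMap.proj k).comp (y' p)) (hyc k)
      (fun p hp => (hasFDerivAt_pi'.1 (hy' p hp)) k) (fun p hp => hpde p hp k)
    have h' := mul_le_mul_of_nonneg_left h (hq k).le
    rw [mul_add, mul_sub] at h'
    simp only [← intervalIntegral.integral_const_mul] at h' ⊢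
    have e₁ : ∀ t x z : ℝ, exp (2 * ν * t) * (exp (c k * x) * q k * l k * z) =
        q k * (l k * exp (2 * ν * t + c k * x) * z) := fun t x z => by rw [exp_add]; ring
    have e₂ : ∀ t x z : ℝ, exp (2 * ν * t) * (exp (c k * x) * q k * z) =
        q k * (exp (2 * ν * t + c k * x) * z) := fun t x z => by rw [exp_add]; ring
    simp only [e₁, e₂]
    exact h'
  have hsum := Finset.sum_le_sum fun k (_ : k ∈ Finset.univ) => hcomp k
  rw [Finset.sum_add_distrib, Finset.sum_sub_distrib, ← Finset.mul_sum, ← Finset.mul_sum,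
    ← intervalIntegral.integral_finsetSum fun k _ => htint k 1 (by simp),
    ← intervalIntegral.integral_finsetSum fun k _ => htint k 0 (by simp),
    ← intervalIntegral.integral_finsetSum fun k _ => hxint k b (by simp [hab]),
    ← intervalIntegral.integral_finsetSum fun k _ => hxint k a (by simp [hab])] at hsum
  have hbdint := intervalIntegral.integral_mono_on hab
    (IntervalIntegrable.sum Finset.univ fun k _ => htint k 0 (by simp))
    (IntervalIntegrable.sum Finset.univ fun k _ => htint k 1 (by simp))
    (fun t ht => by
      simp only [Finset.sum_apply, ← Finset.mul_sum]
      exact mul_le_mul_of_nonneg_left (hbd t ht) (exp_pos _).le)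
  simp only [Finset.sum_apply] at hbdint
  have hfin : exp (2 * ν * b) * (∫ x in (0 : ℝ)..1, ∑ k, exp (c k * x) * q k * y (b, x) k ^ 2) ≤
      exp (2 * ν * a) * ∫ x in (0 : ℝ)..1, ∑ k, exp (c k * x) * q k * y (a, x) k ^ 2 := by
    linarith
  have h := mul_le_mul_of_nonneg_left hfin (exp_pos (-(2 * ν * b))).le
  rw [← mul_assoc, ← mul_assoc, ← exp_add, ← exp_add] at h
  rwa [neg_add_cancel, exp_zero, one_mul,
    show -(2 * ν * b) + 2 * ν * a = -(2 * ν) * (b - a) by ring] at h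

/-- Upper and lower bounds for a weighted quadratic form with weights `exp (c k * x) * q k`. -/
theorem exists_weighted_form_bounds {n : ℕ} (S : Matrix (Fin n) (Fin n) ℝ) (hS : IsUnit S)
    (c q : Fin n → ℝ) (hq : ∀ k, 0 < q k) :
    ∃ c₁ > (0 : ℝ), ∃ c₂ > (0 : ℝ), ∀ v : Fin n → ℝ, ∀ x ∈ Icc (0 : ℝ) 1,
      c₁ * ∑ k, v k ^ 2 ≤ ∑ k, exp (c k * x) * q k * (S *ᵥ v) k ^ 2 ∧
      ∑ k, exp (c k * x) * q k * (S *ᵥ v) k ^ 2 ≤ c₂ * ∑ k, v k ^ 2 := by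
  have hlo : ∃ δ > (0 : ℝ), ∀ k, δ ≤ exp (-|c k|) * q k := by
    rcases isEmpty_or_nonempty (Fin n) with h | h
    · exact ⟨1, one_pos, fun k => h.elim k⟩
    · obtain ⟨k₀, hk₀⟩ := Finite.exists_min fun k => exp (-|c k|) * q k
      exact ⟨_, mul_pos (exp_pos _) (hq k₀), hk₀⟩
  obtain ⟨δ, hδ, hδle⟩ := hlo
  set M := ∑ k, exp |c k| * q k + 1 with hM
  have hMle : ∀ k, exp |c k| * q k ≤ M := fun k => by
    have := Finset.single_le_sum (f := fun k => exp |c k| * q k)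
      (fun k _ => (mul_pos (exp_pos _) (hq k)).le) (Finset.mem_univ k)
    linarith
  have hM0 : 0 < M := by
    have : 0 ≤ ∑ k, exp |c k| * q k :=
      Finset.sum_nonneg fun k _ => (mul_pos (exp_pos _) (hq k)).le
    linarith
  have hpos : ∀ N : Matrix (Fin n) (Fin n) ℝ, 0 < ∑ k, ∑ l, N k l ^ 2 + 1 := fun N => by positivity
  refine ⟨δ / (∑ k, ∑ l, S⁻¹ k l ^ 2 + 1), div_pos hδ (hpos _),
    M * (∑ k, ∑ l, S k l ^ 2 + 1), mul_pos hM0 (hpos _), fun v x hx => ?_⟩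
  have hcx : ∀ k, |c k * x| ≤ |c k| := fun k => by
    rw [abs_mul, abs_of_nonneg hx.1]
    exact mul_le_of_le_one_right (abs_nonneg _) hx.2
  constructor
  · have h := sum_sq_mulVec_le S⁻¹ (S *ᵥ v)
    rw [Matrix.mulVec_mulVec, Matrix.nonsing_inv_mul _ ((Matrix.isUnit_iff_isUnit_det S).1 hS),
      Matrix.one_mulVec] at h
    calc _ ≤ δ / (∑ k, ∑ l, S⁻¹ k l ^ 2 + 1) *
          ((∑ k, ∑ l, S⁻¹ k l ^ 2 + 1) * ∑ k, (S *ᵥ v) k ^ 2) :=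
          mul_le_mul_of_nonneg_left h (div_pos hδ (hpos _)).le
      _ = ∑ k, δ * (S *ᵥ v) k ^ 2 := by
          rw [← mul_assoc, div_mul_cancel₀ _ (hpos _).ne', Finset.mul_sum]
      _ ≤ _ := Finset.sum_le_sum fun k _ => mul_le_mul_of_nonneg_right
          ((hδle k).trans (mul_le_mul_of_nonneg_right
            (exp_le_exp.2 (neg_le_of_abs_le (hcx k))) (hq k).le)) (sq_nonneg _)
  · calc _ ≤ ∑ k, M * (S *ᵥ v) k ^ 2 := Finset.sum_le_sum fun k _ => mul_le_mul_of_nonneg_right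
          ((mul_le_mul_of_nonneg_right
            (exp_le_exp.2 (le_of_abs_le (hcx k))) (hq k).le).trans (hMle k)) (sq_nonneg _)
      _ = M * ∑ k, (S *ᵥ v) k ^ 2 := by rw [Finset.mul_sum]
      _ ≤ M * ((∑ k, ∑ l, S k l ^ 2 + 1) * ∑ k, v k ^ 2) :=
          mul_le_mul_of_nonneg_left (sum_sq_mulVec_le S v) hM0.le
      _ = _ := by ring

/-- Corollary (diagonal source terms):
assuming each Fᵢ is diagonal, under the condition -μΛᵢ⁺ + Fᵢ ≤ -νIₙ together with the
boundary inequality and the common-Lyapunov equalities, the switched linear hyperbolic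
system is globally uniformly exponentially stable with respect to all switching signals.
A switching signal is encoded by its values `sig : ℝ → I` together with its set `times`
of switching times (its discontinuities), and a classical solution is a continuous
function which is C¹ and satisfies the PDE and boundary conditions of the active mode
on every interval free of switching times. -/
theorem stmt_11
    (n : ℕ) (hn : 1 ≤ n) (I : Type) [Fintype I] [Nonempty I]
    (m : ℕ) (hm : m ≤ n)
    (S : I → Matrix (Fin n) (Fin n) ℝ) (hS : ∀ i, IsUnit (S i))
    (lam : I → Fin n → ℝ)
    (hlam : ∀ i (k : Fin n), if (k : ℕ) < m then lam i k < 0 else 0 < lam i k)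
    (A L F : I → Matrix (Fin n) (Fin n) ℝ)
    (hL : ∀ i, L i = (S i)⁻¹ * Matrix.diagonal (lam i) * S i)
    (hF : ∀ i, F i = S i * A i * (S i)⁻¹)
    -- each source term Fᵢ is diagonal
    (hFdiag : ∀ i, (F i).IsDiag)
    (G : I → Matrix (Fin n) (Fin n) ℝ)
    (B0 B1 : I → Matrix (Fin n) (Fin n) ℝ)
    -- B⁰ᵢ = [[-Gᵢ₋₋, 0],[-Gᵢ₊₋, I]] Sᵢ  and  B¹ᵢ = [[I, -Gᵢ₋₊],[0, -Gᵢ₊₊]] Sᵢ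
    (hB0 : ∀ i, B0 i = (Matrix.of fun k l : Fin n =>
        if (l : ℕ) < m then -(G i k l) else if k = l then (1:ℝ) else 0) * S i)
    (hB1 : ∀ i, B1 i = (Matrix.of fun k l : Fin n =>
        if (l : ℕ) < m then (if k = l then (1:ℝ) else 0) else -(G i k l)) * S i)
    (ν μ : ℝ) (hν : 0 < ν)
    (q : I → Fin n → ℝ) (hq : ∀ i k, 0 < q i k)
    -- 𝒬ᵢ(x) = diag[e^{2μx} Qᵢ⁻, e^{-2μx} Qᵢ⁺]
    (Qx : I → ℝ → Matrix (Fin n) (Fin n) ℝ)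
    (hQx : ∀ i x, Qx i x = Matrix.diagonal (fun k : Fin n =>
        if (k : ℕ) < m then Real.exp (2 * μ * x) * q i k
        else Real.exp (-(2 * μ * x)) * q i k))
    -- E₀ᵢ = [[I, 0],[Gᵢ₊₋, Gᵢ₊₊]],  E₁ᵢ = [[Gᵢ₋₋, Gᵢ₋₊],[0, I]]
    (E0 E1 : I → Matrix (Fin n) (Fin n) ℝ)
    (hE0 : ∀ i, E0 i = Matrix.of fun k l : Fin n =>
        if (k : ℕ) < m then (if k = l then (1:ℝ) else 0) else G i k l)
    (hE1 : ∀ i, E1 i = Matrix.of fun k l : Fin n =>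
        if (k : ℕ) < m then G i k l else if k = l then (1:ℝ) else 0)
    -- -μΛᵢ⁺ + Fᵢ ≤ -νIₙ
    (hlmi1 : ∀ i,
      matLE (-μ • Matrix.diagonal (fun k => |lam i k|) + F i)
            (-ν • (1 : Matrix (Fin n) (Fin n) ℝ)))
    (hlmi2 : ∀ i,
      matLE ((E0 i)ᵀ * (Qx i 0 * Matrix.diagonal (lam i)) * E0 i)
            ((E1 i)ᵀ * (Qx i 1 * Matrix.diagonal (lam i)) * E1 i))
    -- (Sᵢ⁻)ᵀ Qᵢ⁻ Sᵢ⁻ = (Sⱼ⁻)ᵀ Qⱼ⁻ Sⱼ⁻ and (Sᵢ⁺)ᵀ Qᵢ⁺ Sᵢ⁺ = (Sⱼ⁺)ᵀ Qⱼ⁺ Sⱼ⁺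
    (heqm : ∀ i j,
      (S i)ᵀ * Matrix.diagonal (fun k : Fin n => if (k : ℕ) < m then q i k else 0) * S i
        = (S j)ᵀ * Matrix.diagonal (fun k : Fin n => if (k : ℕ) < m then q j k else 0) * S j)
    (heqp : ∀ i j,
      (S i)ᵀ * Matrix.diagonal (fun k : Fin n => if (k : ℕ) < m then 0 else q i k) * S i
        = (S j)ᵀ * Matrix.diagonal (fun k : Fin n => if (k : ℕ) < m then 0 else q j k) * S j) :
    ∃ ν' > (0:ℝ), ∃ C > (0:ℝ),
      ∀ (sig : ℝ → I) (times : Set ℝ),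
        -- switching times are positive and locally finite
        (∀ t ∈ times, 0 < t) →
        (∀ T : ℝ, (times ∩ Icc 0 T).Finite) →
        -- `sig` is constant (hence right-continuous) between switching times
        (∀ s t : ℝ, 0 ≤ s → s ≤ t → (∀ u, s < u → u ≤ t → u ∉ times) → sig t = sig s) →
        -- switching times are genuine discontinuities of `sig`
        (∀ t ∈ times, ∀ ε > (0:ℝ), ∃ s, t - ε < s ∧ s < t ∧ sig s ≠ sig t) →
        ∀ w : ℝ → ℝ → Fin n → ℝ,
          -- `w` is continuous on [0,∞) × [0,1]
          ContinuousOn (fun pt : ℝ × ℝ => w pt.1 pt.2) (Ici (0:ℝ) ×ˢ Icc (0:ℝ) 1) →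
          -- on every interval free of switching times, `w` is C¹ and satisfies the PDE
          -- and the boundary conditions of the active mode
          (∀ a b : ℝ, 0 ≤ a → a < b → (∀ u, a < u → u < b → u ∉ times) →
            ContDiffOn ℝ 1 (fun pt : ℝ × ℝ => w pt.1 pt.2) (Icc a b ×ˢ Icc (0:ℝ) 1) ∧
            (∀ t ∈ Icc a b, ∀ x ∈ Icc (0:ℝ) 1,
              fderivWithin ℝ (fun pt : ℝ × ℝ => w pt.1 pt.2)
                  (Icc a b ×ˢ Icc (0:ℝ) 1) (t, x) (1, 0)
                + (L (sig a)).mulVec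
                    (fderivWithin ℝ (fun pt : ℝ × ℝ => w pt.1 pt.2)
                      (Icc a b ×ˢ Icc (0:ℝ) 1) (t, x) (0, 1))
                = (A (sig a)).mulVec (w t x)) ∧
            (∀ t ∈ Icc a b,
              (B0 (sig a)).mulVec (w t 0) + (B1 (sig a)).mulVec (w t 1) = 0)) →
          ∀ t ≥ (0:ℝ),
            Real.sqrt (∫ x in (0:ℝ)..1, ∑ k, (w t x k) ^ 2)
              ≤ C * Real.exp (-ν' * t) * Real.sqrt (∫ x in (0:ℝ)..1, ∑ k, (w 0 x k) ^ 2) := by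
  have hdet : ∀ i, IsUnit (S i).det := fun i => (Matrix.isUnit_iff_isUnit_det _).1 (hS i)
  set c : Fin n → ℝ := fun k => if (k : ℕ) < m then 2 * μ else -(2 * μ) with hc
  have hQ : ∀ i x, Qx i x * Matrix.diagonal (lam i) =
      Matrix.diagonal fun k => exp (c k * x) * q i k * lam i k := by
    intro i x
    rw [hQx, Matrix.diagonal_mul_diagonal]
    congr 1
    funext k
    by_cases hk : (k : ℕ) < m <;> simp [hc, hk]
  have hdamp : ∀ i k, 2 * ν + 2 * F i k k + c k * lam i k ≤ 0 := by
    intro i k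
    have h := (hlmi1 i).diag_nonneg (i := k)
    simp only [Matrix.sub_apply, Matrix.add_apply, Matrix.smul_apply, Matrix.one_apply_eq,
      Matrix.diagonal_apply_eq, smul_eq_mul] at h
    have hl := hlam i k
    by_cases hk : (k : ℕ) < m
    · simp only [hk, if_true] at hl
      rw [abs_of_neg hl] at h
      simp only [hc, hk, if_true]
      linarith
    · simp only [hk, if_false] at hl
      rw [abs_of_pos hl] at h
      simp only [hc, hk, if_false]
      linarith
  have hbdry : ∀ i (v₀ v₁ : Fin n → ℝ), B0 i *ᵥ v₀ + B1 i *ᵥ v₁ = 0 →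
      ∑ k, exp (c k * 0) * q i k * lam i k * (S i *ᵥ v₀) k ^ 2 ≤
        ∑ k, exp (c k * 1) * q i k * lam i k * (S i *ᵥ v₁) k ^ 2 := by
    intro i v₀ v₁ hbc
    set z : Fin n → ℝ := fun k => if (k : ℕ) < m then (S i *ᵥ v₀) k else (S i *ᵥ v₁) k with hz
    rw [hB0, hB1, ← Matrix.mulVec_mulVec, ← Matrix.mulVec_mulVec] at hbc
    have hrow : ∀ k : Fin n, (if (k : ℕ) < m then (S i *ᵥ v₁) k else (S i *ᵥ v₀) k) =
        (G i *ᵥ z) k := by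
      intro k
      have h := congrFun hbc k
      simp only [Pi.add_apply, Matrix.mulVec, dotProduct, Matrix.of_apply, Pi.zero_apply] at h
      rw [← Finset.sum_add_distrib] at h
      have hsplit : ∀ (s₀ s₁ : Fin n → ℝ), (∑ l : Fin n,
          ((if (l : ℕ) < m then -(G i k l) else if k = l then (1 : ℝ) else 0) * s₀ l +
          (if (l : ℕ) < m then (if k = l then (1 : ℝ) else 0) else -(G i k l)) * s₁ l)) =
          (if (k : ℕ) < m then s₁ k else s₀ k) -
            ∑ l : Fin n, G i k l * (if (l : ℕ) < m then s₀ l else s₁ l) := by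
        intro s₀ s₁
        have : (if (k : ℕ) < m then s₁ k else s₀ k) =
            ∑ l : Fin n, if k = l then (if (l : ℕ) < m then s₁ l else s₀ l) else 0 := by simp
        rw [this, ← Finset.sum_sub_distrib]
        refine Finset.sum_congr rfl fun l _ => ?_
        by_cases hl : (l : ℕ) < m <;> by_cases hkl : k = l <;> simp [hl, hkl] <;> ring
      have h2 := hsplit (S i *ᵥ v₀) (S i *ᵥ v₁)
      simp only [Matrix.mulVec, dotProduct] at h2 ⊢
      simp only [hz, Matrix.mulVec, dotProduct]
      linarith
    have h0 : E0 i *ᵥ z = S i *ᵥ v₀ := by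
      funext k
      by_cases hk : (k : ℕ) < m
      · have h : (E0 i *ᵥ z) k = z k := by simp [hE0, Matrix.mulVec, dotProduct, hk]
        rw [h]
        simp only [hz, hk, if_true]
      · have h := hrow k
        simp only [hk, if_false] at h
        rw [h]
        simp [hE0, Matrix.mulVec, dotProduct, hk]
    have h1 : E1 i *ᵥ z = S i *ᵥ v₁ := by
      funext k
      by_cases hk : (k : ℕ) < m
      · have h := hrow k
        simp only [hk, if_true] at h
        rw [h]
        simp [hE1, Matrix.mulVec, dotProduct, hk]
      · have h : (E1 i *ᵥ z) k = z k := by simp [hE1, Matrix.mulVec, dotProduct, hk]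
        rw [h]
        simp only [hz, hk, if_false]
    have h := (hlmi2 i).dotProduct_mulVec_nonneg z
    rw [star_trivial, Matrix.sub_mulVec, dotProduct_sub, hQ, hQ,
      dotProduct_transpose_diagonal_mulVec, dotProduct_transpose_diagonal_mulVec, h0, h1] at h
    linarith
  have hcommon : ∀ i j (v : Fin n → ℝ) (x : ℝ),
      ∑ k, exp (c k * x) * q i k * (S i *ᵥ v) k ^ 2 =
        ∑ k, exp (c k * x) * q j k * (S j *ᵥ v) k ^ 2 := by
    intro i j v x
    have hdec : ∀ i, ∑ k, exp (c k * x) * q i k * (S i *ᵥ v) k ^ 2 =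
        exp (2 * μ * x) * (v ⬝ᵥ ((S i)ᵀ * Matrix.diagonal (fun k : Fin n =>
          if (k : ℕ) < m then q i k else 0) * S i) *ᵥ v) +
        exp (-(2 * μ) * x) * (v ⬝ᵥ ((S i)ᵀ * Matrix.diagonal (fun k : Fin n =>
          if (k : ℕ) < m then 0 else q i k) * S i) *ᵥ v) := by
      intro i
      rw [dotProduct_transpose_diagonal_mulVec, dotProduct_transpose_diagonal_mulVec,
        Finset.mul_sum, Finset.mul_sum, ← Finset.sum_add_distrib]
      refine Finset.sum_congr rfl fun k _ => ?_
      by_cases hk : (k : ℕ) < m <;> simp [hc, hk] <;> ring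
    rw [hdec, hdec, heqm i j, heqp i j]
  obtain ⟨i₀⟩ := ‹Nonempty I›
  obtain ⟨c₁, hc₁, c₂, hc₂, hbounds⟩ := exists_weighted_form_bounds (S i₀) (hS i₀) c (q i₀) (hq i₀)
  refine ⟨ν, hν, √(c₂ / c₁), Real.sqrt_pos.2 (div_pos hc₂ hc₁), ?_⟩
  intro sig times _ hfin _ _ w hw hsol t ht
  set V : ℝ → ℝ := fun t => ∫ x in (0 : ℝ)..1,
    ∑ k, exp (c k * x) * q i₀ k * (S i₀ *ᵥ w t x) k ^ 2 with hV
  have hdecay : V t ≤ exp (-(2 * ν) * t) * V 0 := by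
    refine exp_decay_of_piecewise hfin (fun a b ha hab hfree => ?_) ht
    obtain ⟨hC1, hpde, hbc⟩ := hsol a b ha hab hfree
    set R := Icc a b ×ˢ Icc (0 : ℝ) 1
    set W : ℝ × ℝ → Fin n → ℝ := fun pt => w pt.1 pt.2
    set i := sig a
    set T : (Fin n → ℝ) →L[ℝ] (Fin n → ℝ) := (Matrix.mulVecLin (S i)).toContinuousLinearMap
    have h := diagonal_transport_energy_le hab.le (lam i) (fun k => F i k k) c (q i) (hq i)
      (hdamp i) (fun p => S i *ᵥ W p) (fun p => T.comp (fderivWithin ℝ W R p))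
      (T.continuous.comp_continuousOn hC1.continuousOn)
      (fun p hp => by
        have hnhds : R ∈ nhds p := prod_mem_nhds (Icc_mem_nhds hp.1.1 hp.1.2)
          (Icc_mem_nhds hp.2.1 hp.2.2)
        have hd := ((hC1.differentiableOn one_ne_zero) p (mem_of_mem_nhds hnhds)).hasFDerivWithinAt
        exact T.hasFDerivAt.comp p (hd.hasFDerivAt hnhds))
      (fun p hp k => by
        have h1 := congrArg (S i *ᵥ ·) (hpde p.1 hp.1 p.2 hp.2)
        have hSL : S i * L i = Matrix.diagonal (lam i) * S i := by
          rw [hL, ← mul_assoc, ← mul_assoc, Matrix.mul_nonsing_inv _ (hdet i), one_mul]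
        have hSA : S i * A i = Matrix.diagonal (fun k => F i k k) * S i := by
          have : Matrix.diagonal (fun k => F i k k) = F i := (hFdiag i).diagonal_diag
          rw [this, hF, mul_assoc, Matrix.nonsing_inv_mul _ (hdet i), mul_one]
        simp only [Matrix.mulVec_add, Matrix.mulVec_mulVec, hSL, hSA] at h1
        simp only [← Matrix.mulVec_mulVec] at h1
        have h2 := congrFun h1 k
        simp only [Pi.add_apply, Matrix.mulVec_diagonal] at h2
        exact h2)
      (fun t ht => hbdry i _ _ (hbc t ht))
    simp only [hV, hcommon i₀ i]
    exact h
  have hwx : ∀ s, 0 ≤ s → ContinuousOn (fun x => w s x) (Icc 0 1) := fun s hs =>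
    hw.comp (f := fun x : ℝ => (s, x)) (by fun_prop) fun x hx => ⟨hs, hx⟩
  have hwi : ∀ s, 0 ≤ s → IntervalIntegrable (fun x => ∑ k, w s x k ^ 2)
      MeasureTheory.volume 0 1 := fun s hs => by
    refine ContinuousOn.intervalIntegrable ?_
    rw [uIcc_of_le zero_le_one]
    exact (show Continuous fun v : Fin n → ℝ => ∑ k, v k ^ 2 by fun_prop).comp_continuousOn
      (hwx s hs)
  have hVi : ∀ s, 0 ≤ s → IntervalIntegrable
      (fun x => ∑ k, exp (c k * x) * q i₀ k * (S i₀ *ᵥ w s x) k ^ 2)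
      MeasureTheory.volume 0 1 := fun s hs => by
    refine ContinuousOn.intervalIntegrable ?_
    rw [uIcc_of_le zero_le_one]
    refine continuousOn_finsetSum _ fun k _ => ContinuousOn.mul (by fun_prop) ?_
    exact (show Continuous fun v : Fin n → ℝ => (S i₀ *ᵥ v) k ^ 2 by
      simp only [Matrix.mulVec, dotProduct]; fun_prop).comp_continuousOn (hwx s hs)
  have hlow : c₁ * (∫ x in (0 : ℝ)..1, ∑ k, w t x k ^ 2) ≤ V t := by
    rw [← intervalIntegral.integral_const_mul]
    exact intervalIntegral.integral_mono_on zero_le_one ((hwi t ht).const_mul c₁) (hVi t ht)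
      fun x hx => (hbounds _ x hx).1
  have hup : V 0 ≤ c₂ * ∫ x in (0 : ℝ)..1, ∑ k, w 0 x k ^ 2 := by
    rw [← intervalIntegral.integral_const_mul]
    exact intervalIntegral.integral_mono_on zero_le_one (hVi 0 le_rfl)
      ((hwi 0 le_rfl).const_mul c₂) fun x hx => (hbounds _ x hx).2
  have hexp : exp (-ν * t) = √(exp (-(2 * ν) * t)) := by
    rw [show -(2 * ν) * t = -ν * t + -ν * t by ring, exp_add, Real.sqrt_mul_self (exp_pos _).le]
  rw [hexp, ← Real.sqrt_mul (div_pos hc₂ hc₁).le,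
    ← Real.sqrt_mul (mul_pos (div_pos hc₂ hc₁) (exp_pos _)).le]
  refine Real.sqrt_le_sqrt ?_
  rw [div_mul_eq_mul_div, div_mul_eq_mul_div, le_div_iff₀ hc₁, mul_comm _ c₁]
  calc _ ≤ exp (-(2 * ν) * t) * V 0 := hlow.trans hdecay
    _ ≤ exp (-(2 * ν) * t) * (c₂ * ∫ x in (0 : ℝ)..1, ∑ k, w 0 x k ^ 2) :=
      mul_le_mul_of_nonneg_left hup (exp_pos _).le
    _ = _ := by ring
end
end

section
/- Assume m_i = 0 for all i ∈ I (all characteristic velocities positive, so each Λ_i is diagonal positive definite), and that there exist ν > 0, μ ∈ ℝ and diagonal positive definite matrices Q_i ∈ ℝ^{n×n} such that for all i ∈ I: −2μQ_iΛ_i + F_iᵀQ_i + Q_iF_i ≤ −2νIₙ, Q_i ≤ Iₙ, and G_iᵀQ_iΛ_iG_i ≤ e^{−2μ}Q_iΛ_i, together with S_iᵀQ_iS_i = S_jᵀQ_jS_j for all i,j ∈ I. Then the switched linear hyperbolic system is globally uniformly exponentially stable with respect to the set of all switching signals: there exist ν' > 0 and C > 0 such that for every switching signal σ and every classical solution w,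 ‖w(t,·)‖_{L²((0,1);ℝⁿ)} ≤ C e^{−ν't} ‖w(0,·)‖_{L²((0,1);ℝⁿ)} for all t ≥ 0. -/
open Matrix Set Real

noncomputable section

/-- The diagonal quadratic form `∑ cₖ vₖ²`. -/
def weightedSq {ι : Type*} [Fintype ι] (c v : ι → ℝ) : ℝ := ∑ k, c k * v k ^ 2

section QuadraticForms

variable {ι : Type*} [Fintype ι]

lemma continuous_weightedSq (c : ι → ℝ) : Continuous (weightedSq c) := by
  unfold weightedSq
  fun_prop

lemma matLE.dotProduct_mulVec_le {A B : Matrix ι ι ℝ} (h : matLE A B) (v : ι → ℝ) :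
    v ⬝ᵥ (A *ᵥ v) ≤ v ⬝ᵥ (B *ᵥ v) := by
  have := h.dotProduct_mulVec_nonneg v
  rw [star_trivial, sub_mulVec, dotProduct_sub] at this
  linarith

lemma exists_sum_sq_mulVec_le (M : Matrix ι ι ℝ) :
    ∃ K > 0, ∀ v : ι → ℝ, ∑ k, (M *ᵥ v) k ^ 2 ≤ K * ∑ k, v k ^ 2 := by
  refine ⟨∑ i, ∑ j, M i j ^ 2 + 1, by positivity, fun v => ?_⟩
  have h : ∑ k, (M *ᵥ v) k ^ 2 ≤ (∑ i, ∑ j, M i j ^ 2) * ∑ k, v k ^ 2 := by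
    rw [Finset.sum_mul]
    exact Finset.sum_le_sum fun k _ => Finset.sum_mul_sq_le_sq_mul_sq _ _ _
  have : 0 ≤ ∑ k, v k ^ 2 := by positivity
  linarith

variable [DecidableEq ι]

lemma dotProduct_diagonal_mulVec_self (c v : ι → ℝ) :
    v ⬝ᵥ (diagonal c *ᵥ v) = weightedSq c v := by
  simp only [dotProduct, mulVec_diagonal, weightedSq]
  exact Finset.sum_congr rfl fun k _ => by ring

lemma weightedSq_mulVec (c : ι → ℝ) (M : Matrix ι ι ℝ) (v : ι → ℝ) :
    weightedSq c (M *ᵥ v) = v ⬝ᵥ ((Mᵀ * diagonal c * M) *ᵥ v) := by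
  rw [← dotProduct_diagonal_mulVec_self, ← mulVec_mulVec, ← mulVec_mulVec, dotProduct_mulVec v,
    vecMul_transpose]

lemma weightedSq_le_of_matLE_one {q : ι → ℝ} (h : matLE (diagonal q) 1) (v : ι → ℝ) :
    weightedSq q v ≤ v ⬝ᵥ v := by
  simpa [dotProduct_diagonal_mulVec_self] using h.dotProduct_mulVec_le v

lemma weightedSq_mulVec_le_of_matLE {c : ι → ℝ} {r : ℝ} {G : Matrix ι ι ℝ}
    (h : matLE (Gᵀ * diagonal c * G) (r • diagonal c)) (v : ι → ℝ) :
    weightedSq c (G *ᵥ v) ≤ r * weightedSq c v := by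
  simpa [weightedSq_mulVec, smul_mulVec, dotProduct_diagonal_mulVec_self]
    using h.dotProduct_mulVec_le v

/-- The dissipation inequality expressed by the first matrix inequality. -/
lemma dissipation_of_matLE {q lam : ι → ℝ} {F : Matrix ι ι ℝ} {μ ν : ℝ} (hν : 0 ≤ ν)
    (h : matLE (-(2 * μ) • (diagonal q * diagonal lam) + Fᵀ * diagonal q + diagonal q * F)
      (-(2 * ν) • (1 : Matrix ι ι ℝ))) (hq : matLE (diagonal q) 1) (v : ι → ℝ) :
    2 * ν * weightedSq q v - 2 * μ * weightedSq (q * lam) v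
      + ∑ k, 2 * q k * v k * (F *ᵥ v) k ≤ 0 := by
  have h₁ := h.dotProduct_mulVec_le v
  have h₂ : v ⬝ᵥ ((Fᵀ * diagonal q) *ᵥ v) = ∑ k, q k * v k * (F *ᵥ v) k := by
    rw [← mulVec_mulVec, dotProduct_mulVec v, vecMul_transpose]
    simp only [dotProduct, mulVec_diagonal]
    exact Finset.sum_congr rfl fun k _ => by ring
  have h₃ : v ⬝ᵥ ((diagonal q * F) *ᵥ v) = ∑ k, q k * v k * (F *ᵥ v) k := by
    rw [← mulVec_mulVec]
    simp only [dotProduct, mulVec_diagonal]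
    exact Finset.sum_congr rfl fun k _ => by ring
  have h₄ : ∑ k, 2 * q k * v k * (F *ᵥ v) k = 2 * ∑ k, q k * v k * (F *ᵥ v) k := by
    rw [Finset.mul_sum]
    exact Finset.sum_congr rfl fun k _ => by ring
  rw [add_mulVec, add_mulVec, dotProduct_add, dotProduct_add, h₂, h₃, diagonal_mul_diagonal,
    smul_mulVec, smul_mulVec, dotProduct_smul, dotProduct_smul, dotProduct_diagonal_mulVec_self,
    one_mulVec, smul_eq_mul, smul_eq_mul] at h₁
  have h₅ := mul_le_mul_of_nonneg_left (weightedSq_le_of_matLE_one hq v) hν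
  change -(2 * μ) * weightedSq (q * lam) v + _ + _ ≤ _ at h₁
  rw [h₄]
  linarith

/-- For invertible `S` and positive weights, `v ↦ ∑ qₖ (S v)ₖ²` is equivalent to `∑ vₖ²`. -/
lemma exists_weightedSq_mulVec_equiv {q : ι → ℝ} (hq : ∀ k, 0 < q k) {S : Matrix ι ι ℝ}
    (hS : IsUnit S) : ∃ K > 0, ∃ K' > 0, ∀ v : ι → ℝ,
      weightedSq q (S *ᵥ v) ≤ K * ∑ k, v k ^ 2 ∧ ∑ k, v k ^ 2 ≤ K' * weightedSq q (S *ᵥ v) := by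
  set d : ι → ℝ := fun k => √(q k)
  obtain ⟨K, hK, hKv⟩ := exists_sum_sq_mulVec_le (diagonal d * S)
  obtain ⟨K', hK', hKv'⟩ := exists_sum_sq_mulVec_le (S⁻¹ * diagonal fun k => (d k)⁻¹)
  have hd : ∀ v, ∑ k, ((diagonal d * S) *ᵥ v) k ^ 2 = weightedSq q (S *ᵥ v) := fun v => by
    simp only [← mulVec_mulVec, mulVec_diagonal, weightedSq, mul_pow]
    exact Finset.sum_congr rfl fun k _ => by rw [Real.sq_sqrt (hq k).le]
  have hinv : (S⁻¹ * diagonal fun k => (d k)⁻¹) * (diagonal d * S) = 1 := by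
    have : (diagonal fun k => (d k)⁻¹) * diagonal d = 1 := by
      rw [diagonal_mul_diagonal, ← diagonal_one]
      congr 1
      ext k
      exact inv_mul_cancel₀ (Real.sqrt_pos.2 (hq k)).ne'
    rw [Matrix.mul_assoc, ← Matrix.mul_assoc _ (diagonal d), this, Matrix.one_mul]
    exact nonsing_inv_mul _ ((isUnit_iff_isUnit_det _).1 hS)
  refine ⟨K, hK, K', hK', fun v => ⟨hd v ▸ hKv v, ?_⟩⟩
  have := hKv' ((diagonal d * S) *ᵥ v)
  rwa [mulVec_mulVec, hinv, one_mulVec, hd] at this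

end QuadraticForms

section EnergyEstimate

variable {n : ℕ}

/-- The derivative of `e^{α t + β x} ∑ cₖ uₖ²` when `u` has derivative `D` at `p`. -/
def weightedSqDeriv (α β : ℝ) (c : Fin n → ℝ) (p : ℝ × ℝ) (v : Fin n → ℝ)
    (D : ℝ × ℝ →L[ℝ] Fin n → ℝ) : ℝ × ℝ →L[ℝ] ℝ :=
  Real.exp (α * p.1 + β * p.2) •
    (weightedSq c v • (α • ContinuousLinearMap.fst ℝ ℝ ℝ + β • ContinuousLinearMap.snd ℝ ℝ ℝ)
      + ∑ k, (2 * c k * v k) • (ContinuousLinearMap.proj k).comp D)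

lemma hasFDerivAt_exp_mul_weightedSq (α β : ℝ) (c : Fin n → ℝ) {u : ℝ × ℝ → Fin n → ℝ}
    {D : ℝ × ℝ →L[ℝ] Fin n → ℝ} {p : ℝ × ℝ} (hu : HasFDerivAt u D p) :
    HasFDerivAt (fun p => Real.exp (α * p.1 + β * p.2) * weightedSq c (u p))
      (weightedSqDeriv α β c p (u p) D) p := by
  have hk : ∀ k, HasFDerivAt (fun p => u p k) ((ContinuousLinearMap.proj k).comp D) p :=
    hasFDerivAt_pi'.1 hu
  have hs : HasFDerivAt (fun p => weightedSq c (u p))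
      (∑ k, (2 * c k * u p k) • (ContinuousLinearMap.proj k).comp D) p := by
    unfold weightedSq
    refine HasFDerivAt.fun_sum fun k _ => ?_
    refine (((hk k).pow 2).const_mul (c k)).congr_fderiv ?_
    ext <;> simp <;> ring
  have hl : HasFDerivAt (fun p : ℝ × ℝ => α * p.1 + β * p.2)
      (α • ContinuousLinearMap.fst ℝ ℝ ℝ + β • ContinuousLinearMap.snd ℝ ℝ ℝ) p :=
    (hasFDerivAt_fst.const_mul α).add (hasFDerivAt_snd.const_mul β)
  refine (hl.exp.mul hs).congr_fderiv ?_
  ext <;> simp [weightedSqDeriv] <;> ring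

lemma continuousOn_weightedSqDeriv (α β : ℝ) (c : Fin n → ℝ) {R : Set (ℝ × ℝ)}
    {u : ℝ × ℝ → Fin n → ℝ} {D : ℝ × ℝ → ℝ × ℝ →L[ℝ] Fin n → ℝ} (hu : ContinuousOn u R)
    (hD : ContinuousOn D R) :
    ContinuousOn (fun p => weightedSqDeriv α β c p (u p) (D p)) R := by
  have hw : ContinuousOn (fun p => weightedSq c (u p)) R :=
    (continuous_weightedSq c).comp_continuousOn hu
  have hE : ContinuousOn (fun p : ℝ × ℝ => Real.exp (α * p.1 + β * p.2)) R := by fun_prop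
  unfold weightedSqDeriv
  refine hE.smul ((hw.smul continuousOn_const).add ?_)
  refine continuousOn_finsetSum _ fun k _ => ?_
  have hk : ContinuousOn (fun p => u p k) R := (continuous_apply k).comp_continuousOn hu
  exact (continuousOn_const.mul hk).smul (continuousOn_const.clm_comp hD)

/-- In diagonal coordinates the energy `e^{2νt} ∫ e^{-2μx} ∑ qₖ uₖ²` does not increase along a
classical solution of one mode. -/
lemma energy_le_of_mode {a b μ ν : ℝ} (hab : a < b) {q lam : Fin n → ℝ}
    {F G : Matrix (Fin n) (Fin n) ℝ}
    (hdis : ∀ v : Fin n → ℝ, 2 * ν * weightedSq q v - 2 * μ * weightedSq (q * lam) v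
      + ∑ k, 2 * q k * v k * (F *ᵥ v) k ≤ 0)
    (hbd : ∀ v : Fin n → ℝ,
      weightedSq (q * lam) (G *ᵥ v) ≤ Real.exp (-(2 * μ)) * weightedSq (q * lam) v)
    {u : ℝ × ℝ → Fin n → ℝ} (hu : ContDiffOn ℝ 1 u (Icc a b ×ˢ Icc (0 : ℝ) 1))
    (hpde : ∀ p ∈ Icc a b ×ˢ Icc (0 : ℝ) 1,
      fderivWithin ℝ u (Icc a b ×ˢ Icc (0 : ℝ) 1) p (1, 0)
        + diagonal lam *ᵥ fderivWithin ℝ u (Icc a b ×ˢ Icc (0 : ℝ) 1) p (0, 1) = F *ᵥ u p)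
    (hbc : ∀ t ∈ Icc a b, u (t, 0) = G *ᵥ u (t, 1)) :
    ∫ x in (0 : ℝ)..1, Real.exp (2 * ν * b + -(2 * μ) * x) * weightedSq q (u (b, x))
      ≤ ∫ x in (0 : ℝ)..1, Real.exp (2 * ν * a + -(2 * μ) * x) * weightedSq q (u (a, x)) := by
  set R : Set (ℝ × ℝ) := Icc a b ×ˢ Icc (0 : ℝ) 1
  have hRI : Icc (a, (0 : ℝ)) (b, 1) = R := (Icc_prod_Icc a b 0 1).symm
  have hRu : UniqueDiffOn ℝ R := (uniqueDiffOn_Icc hab).prod (uniqueDiffOn_Icc zero_lt_one)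
  have hcu := hu.continuousOn
  have hD := hu.continuousOn_fderivWithin hRu le_rfl
  set D := fderivWithin ℝ u R
  have hder : ∀ p ∈ Ioo a b ×ˢ Ioo (0 : ℝ) 1, HasFDerivAt u (D p) p := fun p hp => by
    have hn : R ∈ nhds p := prod_mem_nhds (Icc_mem_nhds hp.1.1 hp.1.2) (Icc_mem_nhds hp.2.1 hp.2.2)
    exact ((hu.differentiableOn one_ne_zero p (mem_of_mem_nhds hn)).hasFDerivWithinAt).hasFDerivAt hn
  have hcont : ∀ c : Fin n → ℝ, ContinuousOn
      (fun p : ℝ × ℝ => Real.exp (2 * ν * p.1 + -(2 * μ) * p.2) * weightedSq c (u p)) R :=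
    fun c => ContinuousOn.mul (by fun_prop) ((continuous_weightedSq c).comp_continuousOn hcu)
  have hfd := continuousOn_weightedSqDeriv (2 * ν) (-(2 * μ)) q hcu hD
  have hgd := continuousOn_weightedSqDeriv (2 * ν) (-(2 * μ)) (q * lam) hcu hD
  have hdiv := MeasureTheory.integral_divergence_prod_Icc_of_hasFDerivAt_of_le
    (fun p : ℝ × ℝ => Real.exp (2 * ν * p.1 + -(2 * μ) * p.2) * weightedSq q (u p))
    (fun p : ℝ × ℝ => Real.exp (2 * ν * p.1 + -(2 * μ) * p.2) * weightedSq (q * lam) (u p))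
    (fun p => weightedSqDeriv (2 * ν) (-(2 * μ)) q p (u p) (D p))
    (fun p => weightedSqDeriv (2 * ν) (-(2 * μ)) (q * lam) p (u p) (D p))
    (a, 0) (b, 1) ⟨hab.le, zero_le_one⟩ (hRI ▸ hcont q) (hRI ▸ hcont (q * lam))
    (fun p hp => hasFDerivAt_exp_mul_weightedSq _ _ _ (hder p hp))
    (fun p hp => hasFDerivAt_exp_mul_weightedSq _ _ _ (hder p hp))
    (by
      rw [hRI]
      exact ((hfd.clm_apply continuousOn_const).add
        (hgd.clm_apply continuousOn_const)).integrableOn_compact (isCompact_Icc.prod isCompact_Icc))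
  have hneg : ∫ p in Icc (a, (0 : ℝ)) (b, 1),
      (weightedSqDeriv (2 * ν) (-(2 * μ)) q p (u p) (D p) (1, 0)
        + weightedSqDeriv (2 * ν) (-(2 * μ)) (q * lam) p (u p) (D p) (0, 1)) ≤ 0 := by
    refine MeasureTheory.setIntegral_nonpos measurableSet_Icc fun p hp => ?_
    rw [hRI] at hp
    have hk : ∑ k, 2 * q k * u p k * (F *ᵥ u p) k = ∑ k, 2 * q k * u p k * D p (1, 0) k
        + ∑ k, 2 * (q k * lam k) * u p k * D p (0, 1) k := by
      rw [← hpde p hp, ← Finset.sum_add_distrib]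
      exact Finset.sum_congr rfl fun k _ => by simp only [Pi.add_apply, mulVec_diagonal]; ring
    have := mul_nonpos_of_nonneg_of_nonpos
      (Real.exp_pos (2 * ν * p.1 + -(2 * μ) * p.2)).le (hdis (u p))
    rw [hk] at this
    refine le_of_eq_of_le ?_ this
    simp [weightedSqDeriv]
    ring
  have hedge : ∀ y ∈ Icc (0 : ℝ) 1, ContinuousOn (fun t =>
      Real.exp (2 * ν * t + -(2 * μ) * y) * weightedSq (q * lam) (u (t, y))) (uIcc a b) :=
    fun y hy => (hcont (q * lam)).comp (f := fun t : ℝ => (t, y)) (by fun_prop)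
      fun t ht => ⟨by rwa [uIcc_of_le hab.le] at ht, hy⟩
  have hflux := intervalIntegral.integral_mono_on (μ := MeasureTheory.volume) hab.le
    (hedge 0 (by simp)).intervalIntegrable (hedge 1 (by simp)).intervalIntegrable
    (fun t ht => by
      rw [hbc t ht]
      calc _ ≤ Real.exp (2 * ν * t + -(2 * μ) * 0)
            * (Real.exp (-(2 * μ)) * weightedSq (q * lam) (u (t, 1))) := by gcongr; exact hbd _
        _ = _ := by rw [← mul_assoc, ← Real.exp_add]; ring_nf)
  dsimp only at hdiv
  linarith

/-- The energy estimate for one mode in the original coordinates `w`, where `u = S w`. -/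
lemma energy_le_of_mode_mulVec {a b μ ν : ℝ} (hab : a < b) {q lam : Fin n → ℝ}
    {S L A F G : Matrix (Fin n) (Fin n) ℝ} (hS : IsUnit S) (hL : L = S⁻¹ * diagonal lam * S)
    (hF : F = S * A * S⁻¹)
    (hdis : ∀ v : Fin n → ℝ, 2 * ν * weightedSq q v - 2 * μ * weightedSq (q * lam) v
      + ∑ k, 2 * q k * v k * (F *ᵥ v) k ≤ 0)
    (hbd : ∀ v : Fin n → ℝ,
      weightedSq (q * lam) (G *ᵥ v) ≤ Real.exp (-(2 * μ)) * weightedSq (q * lam) v)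
    {w : ℝ → ℝ → Fin n → ℝ}
    (hw : ContDiffOn ℝ 1 (fun p : ℝ × ℝ => w p.1 p.2) (Icc a b ×ˢ Icc (0 : ℝ) 1))
    (hpde : ∀ t ∈ Icc a b, ∀ x ∈ Icc (0 : ℝ) 1,
      fderivWithin ℝ (fun p : ℝ × ℝ => w p.1 p.2) (Icc a b ×ˢ Icc (0 : ℝ) 1) (t, x) (1, 0)
        + L *ᵥ fderivWithin ℝ (fun p : ℝ × ℝ => w p.1 p.2)
          (Icc a b ×ˢ Icc (0 : ℝ) 1) (t, x) (0, 1) = A *ᵥ w t x)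
    (hbc : ∀ t ∈ Icc a b, S *ᵥ w t 0 = G *ᵥ (S *ᵥ w t 1)) :
    ∫ x in (0 : ℝ)..1, Real.exp (2 * ν * b + -(2 * μ) * x) * weightedSq q (S *ᵥ w b x)
      ≤ ∫ x in (0 : ℝ)..1, Real.exp (2 * ν * a + -(2 * μ) * x) * weightedSq q (S *ᵥ w a x) := by
  have hdet : IsUnit S.det := (isUnit_iff_isUnit_det _).1 hS
  have hSL : S * L = diagonal lam * S := by
    rw [hL, Matrix.mul_assoc, ← Matrix.mul_assoc S, mul_nonsing_inv _ hdet, Matrix.one_mul]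
  have hSA : S * A = F * S := by
    rw [hF, Matrix.mul_assoc, nonsing_inv_mul _ hdet, Matrix.mul_one]
  let T : (Fin n → ℝ) →L[ℝ] Fin n → ℝ := LinearMap.toContinuousLinearMap S.mulVecLin
  have hRu : UniqueDiffOn ℝ (Icc a b ×ˢ Icc (0 : ℝ) 1) :=
    (uniqueDiffOn_Icc hab).prod (uniqueDiffOn_Icc zero_lt_one)
  refine energy_le_of_mode hab hdis hbd (u := fun p => S *ᵥ w p.1 p.2)
    (T.contDiff.comp_contDiffOn hw) (fun p hp => ?_) hbc
  have hder := (T.hasFDerivAt.comp_hasFDerivWithinAt p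
    (hw.differentiableOn one_ne_zero p hp).hasFDerivWithinAt).fderivWithin (hRu p hp)
  have hT : ∀ v, T v = S *ᵥ v := fun v => rfl
  change fderivWithin ℝ (T ∘ fun p : ℝ × ℝ => w p.1 p.2) _ p (1, 0) + diagonal lam *ᵥ
    fderivWithin ℝ (T ∘ fun p : ℝ × ℝ => w p.1 p.2) _ p (0, 1) = _
  rw [hder, ContinuousLinearMap.comp_apply, ContinuousLinearMap.comp_apply, hT, hT, mulVec_mulVec,
    ← hSL, ← mulVec_mulVec, ← mulVec_add, hpde p.1 hp.1 p.2 hp.2, mulVec_mulVec, mulVec_mulVec, hSA]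

/-- A quantity that does not increase across intervals whose interior avoids a locally finite set
does not increase at all. -/
lemma le_of_le_of_disjoint_Ioo {times : Set ℝ} (hfin : ∀ T : ℝ, (times ∩ Icc 0 T).Finite)
    {V : ℝ → ℝ} (hV : ∀ a b, 0 ≤ a → a < b → (∀ u, a < u → u < b → u ∉ times) → V b ≤ V a)
    {t : ℝ} (ht : 0 ≤ t) : V t ≤ V 0 := by
  suffices h : ∀ N : ℕ, ∀ a b, 0 ≤ a → a < b → (times ∩ Ioo a b).ncard = N → V b ≤ V a by
    rcases ht.eq_or_lt with rfl | ht
    · exact le_rfl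
    · exact h _ 0 t le_rfl ht rfl
  intro N
  induction N using Nat.strong_induction_on with
  | _ N ih =>
    intro a b ha hab hN
    by_cases hc : ∃ c, a < c ∧ c < b ∧ c ∈ times
    · obtain ⟨c, hac, hcb, hct⟩ := hc
      have hf : (times ∩ Ioo a b).Finite := (hfin b).subset fun x hx =>
        ⟨hx.1, ha.trans hx.2.1.le, hx.2.2.le⟩
      have h₁ : (times ∩ Ioo a c).ncard < N := hN ▸ Set.ncard_lt_ncard
        ⟨fun x hx => ⟨hx.1, hx.2.1, hx.2.2.trans hcb⟩, fun hs =>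
          lt_irrefl c (hs ⟨hct, hac, hcb⟩).2.2⟩ hf
      have h₂ : (times ∩ Ioo c b).ncard < N := hN ▸ Set.ncard_lt_ncard
        ⟨fun x hx => ⟨hx.1, hac.trans hx.2.1, hx.2.2⟩, fun hs =>
          lt_irrefl c (hs ⟨hct, hac, hcb⟩).2.1⟩ hf
      exact (ih _ h₂ c b (ha.trans hac.le) hcb rfl).trans (ih _ h₁ a c ha hac rfl)
    · push Not at hc
      exact hV a b ha hab hc

lemma exp_mul_le_exp_abs {μ x : ℝ} (hx : x ∈ Icc (0 : ℝ) 1) :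
    Real.exp (-(2 * |μ|)) ≤ Real.exp (-(2 * μ) * x) ∧
      Real.exp (-(2 * μ) * x) ≤ Real.exp (2 * |μ|) := by
  have h : |μ * x| ≤ |μ| := by
    rw [abs_mul, abs_of_nonneg hx.1]
    exact mul_le_of_le_one_right (abs_nonneg μ) hx.2
  obtain ⟨h₁, h₂⟩ := abs_le.1 h
  constructor <;> exact Real.exp_le_exp.2 (by linarith)

end EnergyEstimate

/-- Corollary (all characteristic velocities positive, m = 0):
under the matrix inequalities -2μQᵢΛᵢ + FᵢᵀQᵢ + QᵢFᵢ ≤ -2νIₙ, Qᵢ ≤ Iₙ,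
GᵢᵀQᵢΛᵢGᵢ ≤ e^{-2μ}QᵢΛᵢ and the equalities SᵢᵀQᵢSᵢ = SⱼᵀQⱼSⱼ, the switched linear
hyperbolic system is globally uniformly exponentially stable with respect to all
switching signals.
A switching signal is encoded by its values `sig : ℝ → I` together with its set `times`
of switching times (its discontinuities), and a classical solution is a continuous
function which is C¹ and satisfies the PDE and boundary conditions of the active mode
on every interval free of switching times. -/
theorem stmt_13
    (n : ℕ) (hn : 1 ≤ n) (I : Type) [Fintype I] [Nonempty I]
    (S : I → Matrix (Fin n) (Fin n) ℝ) (hS : ∀ i, IsUnit (S i))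
    (lam : I → Fin n → ℝ)
    (hlam : ∀ i (k : Fin n), 0 < lam i k)
    (A L F : I → Matrix (Fin n) (Fin n) ℝ)
    (hL : ∀ i, L i = (S i)⁻¹ * Matrix.diagonal (lam i) * S i)
    (hF : ∀ i, F i = S i * A i * (S i)⁻¹)
    (G : I → Matrix (Fin n) (Fin n) ℝ)
    (ν μ : ℝ) (hν : 0 < ν)
    (q : I → Fin n → ℝ) (hq : ∀ i k, 0 < q i k)
    -- -2μQᵢΛᵢ + FᵢᵀQᵢ + QᵢFᵢ ≤ -2νIₙ and Qᵢ ≤ Iₙ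
    (hlmi1 : ∀ i,
      matLE (-(2 * μ) • (Matrix.diagonal (q i) * Matrix.diagonal (lam i))
              + (F i)ᵀ * Matrix.diagonal (q i) + Matrix.diagonal (q i) * F i)
            (-(2 * ν) • (1 : Matrix (Fin n) (Fin n) ℝ)))
    (hlmi1' : ∀ i, matLE (Matrix.diagonal (q i)) (1 : Matrix (Fin n) (Fin n) ℝ))
    -- GᵢᵀQᵢΛᵢGᵢ ≤ e^{-2μ}QᵢΛᵢ
    (hlmi2 : ∀ i,
      matLE ((G i)ᵀ * (Matrix.diagonal (q i) * Matrix.diagonal (lam i)) * G i)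
            (Real.exp (-(2 * μ)) • (Matrix.diagonal (q i) * Matrix.diagonal (lam i))))
    -- SᵢᵀQᵢSᵢ = SⱼᵀQⱼSⱼ
    (heq : ∀ i j,
      (S i)ᵀ * Matrix.diagonal (q i) * S i = (S j)ᵀ * Matrix.diagonal (q j) * S j) :
    ∃ ν' > (0:ℝ), ∃ C > (0:ℝ),
      ∀ (sig : ℝ → I) (times : Set ℝ),
        -- switching times are positive and locally finite
        (∀ t ∈ times, 0 < t) →
        (∀ T : ℝ, (times ∩ Icc 0 T).Finite) →
        -- `sig` is constant (hence right-continuous) between switching times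
        (∀ s t : ℝ, 0 ≤ s → s ≤ t → (∀ u, s < u → u ≤ t → u ∉ times) → sig t = sig s) →
        -- switching times are genuine discontinuities of `sig`
        (∀ t ∈ times, ∀ ε > (0:ℝ), ∃ s, t - ε < s ∧ s < t ∧ sig s ≠ sig t) →
        ∀ w : ℝ → ℝ → Fin n → ℝ,
          -- `w` is continuous on [0,∞) × [0,1]
          ContinuousOn (fun pt : ℝ × ℝ => w pt.1 pt.2) (Ici (0:ℝ) ×ˢ Icc (0:ℝ) 1) →
          -- on every interval free of switching times, `w` is C¹ and satisfies the PDE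
          -- and the boundary conditions of the active mode
          (∀ a b : ℝ, 0 ≤ a → a < b → (∀ u, a < u → u < b → u ∉ times) →
            ContDiffOn ℝ 1 (fun pt : ℝ × ℝ => w pt.1 pt.2) (Icc a b ×ˢ Icc (0:ℝ) 1) ∧
            (∀ t ∈ Icc a b, ∀ x ∈ Icc (0:ℝ) 1,
              fderivWithin ℝ (fun pt : ℝ × ℝ => w pt.1 pt.2)
                  (Icc a b ×ˢ Icc (0:ℝ) 1) (t, x) (1, 0)
                + (L (sig a)).mulVec
                    (fderivWithin ℝ (fun pt : ℝ × ℝ => w pt.1 pt.2)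
                      (Icc a b ×ˢ Icc (0:ℝ) 1) (t, x) (0, 1))
                = (A (sig a)).mulVec (w t x)) ∧
            (∀ t ∈ Icc a b,
              (S (sig a)).mulVec (w t 0)
                = (G (sig a)).mulVec ((S (sig a)).mulVec (w t 1)))) →
          ∀ t ≥ (0:ℝ),
            Real.sqrt (∫ x in (0:ℝ)..1, ∑ k, (w t x k) ^ 2)
              ≤ C * Real.exp (-ν' * t) * Real.sqrt (∫ x in (0:ℝ)..1, ∑ k, (w 0 x k) ^ 2) := by
  obtain ⟨i₀⟩ := ‹Nonempty I›
  obtain ⟨K, hK, K', hK', hKv⟩ := exists_weightedSq_mulVec_equiv (hq i₀) (hS i₀)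
  have hP : ∀ i v, weightedSq (q i) (S i *ᵥ v) = weightedSq (q i₀) (S i₀ *ᵥ v) := fun i v => by
    rw [weightedSq_mulVec, weightedSq_mulVec, heq i i₀]
  set c := Real.exp (2 * |μ|)
  refine ⟨ν, hν, √(c * c * K * K'), by positivity, ?_⟩
  intro sig times _ hfin _ _ w hwc hw t ht
  have hV := le_of_le_of_disjoint_Ioo hfin (V := fun t => ∫ x in (0 : ℝ)..1,
      Real.exp (2 * ν * t + -(2 * μ) * x) * weightedSq (q i₀) (S i₀ *ᵥ w t x))
    (fun a b ha hab hd => by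
      obtain ⟨hreg, hpde, hbc⟩ := hw a b ha hab hd
      simpa only [hP] using energy_le_of_mode_mulVec hab (hS (sig a)) (hL _) (hF _)
        (dissipation_of_matLE hν.le (hlmi1 _) (hlmi1' _))
        (weightedSq_mulVec_le_of_matLE (c := q (sig a) * lam (sig a))
          (by have h := hlmi2 (sig a); rw [diagonal_mul_diagonal] at h; exact h))
        hreg hpde hbc) ht
  have hslice : ∀ s, 0 ≤ s → ContinuousOn (w s) (uIcc 0 1) := fun s hs =>
    hwc.comp (f := fun x : ℝ => (s, x)) (by fun_prop)
      fun x hx => ⟨hs, by rwa [uIcc_of_le zero_le_one] at hx⟩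
  have hsq : ∀ s, 0 ≤ s → IntervalIntegrable (fun x => ∑ k, w s x k ^ 2)
      MeasureTheory.volume 0 1 := fun s hs =>
    ((by fun_prop : Continuous fun v : Fin n → ℝ => ∑ k, v k ^ 2).comp_continuousOn
      (hslice s hs)).intervalIntegrable
  have hen : ∀ s, 0 ≤ s → IntervalIntegrable (fun x =>
      Real.exp (2 * ν * s + -(2 * μ) * x) * weightedSq (q i₀) (S i₀ *ᵥ w s x))
      MeasureTheory.volume 0 1 := fun s hs =>
    (ContinuousOn.mul (by fun_prop) (((continuous_weightedSq (q i₀)).comp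
      (continuous_const.matrix_mulVec continuous_id)).comp_continuousOn
        (hslice s hs))).intervalIntegrable
  have hpos : ∀ v, 0 ≤ weightedSq (q i₀) v := fun v =>
    Finset.sum_nonneg fun k _ => mul_nonneg (hq i₀ k).le (sq_nonneg _)
  have hlow := intervalIntegral.integral_mono_on zero_le_one (hsq t ht)
    ((hen t ht).const_mul (c * Real.exp (-(2 * ν * t)) * K')) fun x hx => by
      have h₁ : 1 ≤ c * Real.exp (-(2 * μ) * x) := by
        have := (exp_mul_le_exp_abs (μ := μ) hx).1
        rw [Real.exp_neg] at this
        have := mul_le_mul_of_nonneg_left this (Real.exp_pos (2 * |μ|)).le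
        rwa [mul_inv_cancel₀ (Real.exp_pos _).ne'] at this
      have h₂ : Real.exp (-(2 * ν * t)) * Real.exp (2 * ν * t) = 1 := by
        rw [← Real.exp_add]; simp
      calc ∑ k, w t x k ^ 2 ≤ 1 * (K' * weightedSq (q i₀) (S i₀ *ᵥ w t x)) := by
            rw [one_mul]; exact (hKv _).2
        _ ≤ c * Real.exp (-(2 * μ) * x) * (K' * weightedSq (q i₀) (S i₀ *ᵥ w t x)) :=
            mul_le_mul_of_nonneg_right h₁ (mul_nonneg hK'.le (hpos _))
        _ = _ := by
            rw [Real.exp_add]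
            linear_combination (-(c * Real.exp (-(2 * μ) * x) * K'
              * weightedSq (q i₀) (S i₀ *ᵥ w t x))) * h₂
  have hup := intervalIntegral.integral_mono_on zero_le_one (hen 0 le_rfl)
    ((hsq 0 le_rfl).const_mul (c * K)) fun x hx => by
      rw [mul_zero, zero_add, mul_assoc]
      exact mul_le_mul (exp_mul_le_exp_abs hx).2 (hKv _).1 (hpos _) (Real.exp_pos _).le
  rw [intervalIntegral.integral_const_mul] at hlow hup
  have hfinal : ∫ x in (0 : ℝ)..1, ∑ k, w t x k ^ 2
      ≤ c * c * K * K' * Real.exp (-ν * t) ^ 2 * ∫ x in (0 : ℝ)..1, ∑ k, w 0 x k ^ 2 := by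
    have he : Real.exp (-ν * t) ^ 2 = Real.exp (-(2 * ν * t)) := by
      rw [← Real.exp_nat_mul]; congr 1; push_cast; ring
    rw [he]
    refine hlow.trans ((mul_le_mul_of_nonneg_left (hV.trans hup) (by positivity)).trans_eq ?_)
    ring
  calc _ ≤ √(c * c * K * K' * Real.exp (-ν * t) ^ 2 * ∫ x in (0 : ℝ)..1, ∑ k, w 0 x k ^ 2) :=
        Real.sqrt_le_sqrt hfinal
    _ = _ := by
        rw [Real.sqrt_mul (by positivity), Real.sqrt_mul (by positivity),
          Real.sqrt_sq (Real.exp_pos _).le]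
end
end
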